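/- Let r : ℝ → ℝ be twice continuously differentiable and strictly positive, define y(x) = ∫₀ˣ dt / r(t), and let λ ∈ ℂ. Let u : ℝ → ℝ and let φ : ℝ → ℂ be twice differentiable with −φ''(s) + u(s) φ(s) = λ φ(s) for all s ∈ ℝ. Suppose that u(y(x)) = (1/4) r'(x)² − (1/2) r(x) r''(x) for all x ∈ ℝ. Define ψ(x) = r(x)^{1/2} φ(y(x)). Then ψ is twice differentiable and −r(x)² ψ''(x) = λ ψ(x) for all x ∈ ℝ. -/

import Mathlib

/-- **Hopf transformation, converse direction.**
Let `r : ℝ → ℝ` be `C²` and strictly positive, `y x = ∫₀ˣ dt / r t`, `λ ∈ ℂ`.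
Let `u : ℝ → ℝ` and let `φ` be twice differentiable with
`-φ''(s) + u(s) φ(s) = λ φ(s)` for all `s`, and suppose
`u (y x) = (1/4) r'(x)² - (1/2) r(x) r''(x)` for all `x`.
Then `ψ x = √(r x) · φ (y x)` is twice differentiable and satisfies the acoustic
equation `-r(x)² ψ''(x) = λ ψ(x)`. -/
theorem schroedinger_to_acoustic
    (r : ℝ → ℝ) (hr : ContDiff ℝ 2 r) (hrpos : ∀ x, 0 < r x)
    (y : ℝ → ℝ) (hy : ∀ x, y x = ∫ t in (0:ℝ)..x, 1 / r t)
    (lam : ℂ) (u : ℝ → ℝ) (φ φ' φ'' : ℝ → ℂ)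
    (hφ : ∀ s, HasDerivAt φ (φ' s) s)
    (hφ' : ∀ s, HasDerivAt φ' (φ'' s) s)
    (hschr : ∀ s, -φ'' s + (u s : ℂ) * φ s = lam * φ s)
    (hu : ∀ x, u (y x) = (1 / 4) * (deriv r x) ^ 2
        - (1 / 2) * r x * deriv (deriv r) x)
    (ψ : ℝ → ℂ) (hψ : ∀ x, ψ x = (Real.sqrt (r x) : ℂ) * φ (y x)) :
    ∃ ψ' ψ'' : ℝ → ℂ,
      (∀ x, HasDerivAt ψ (ψ' x) x) ∧
      (∀ x, HasDerivAt ψ' (ψ'' x) x) ∧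
      (∀ x, -(r x : ℂ) ^ 2 * ψ'' x = lam * ψ x) := by
  have hr1 : ∀ x, HasDerivAt r (deriv r x) x := fun x =>
    (hr.differentiable (by norm_num) x).hasDerivAt
  have hr2 : ∀ x, HasDerivAt (deriv r) (deriv (deriv r) x) x := fun x =>
    (((contDiff_succ_iff_deriv (n := 1)).1 (hr.of_le (by rw [one_add_one_eq_two]))).2.2.differentiable
      (by norm_num) x).hasDerivAt
  have hcont : Continuous fun t => 1 / r t :=
    continuous_const.div hr.continuous fun x => (hrpos x).ne'
  have hy1 : ∀ x, HasDerivAt y (1 / r x) x := by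
    intro x
    rw [funext hy]
    exact intervalIntegral.integral_hasDerivAt_right (hcont.intervalIntegrable _ _)
      hcont.stronglyMeasurable.stronglyMeasurableAtFilter hcont.continuousAt
  have hq : ∀ x, HasDerivAt (fun x => ((Real.sqrt (r x) : ℝ) : ℂ))
      ((deriv r x / (2 * Real.sqrt (r x)) : ℝ) : ℂ) x := fun x =>
    ((hr1 x).sqrt (hrpos x).ne').ofReal_comp
  have hF : ∀ x, HasDerivAt (fun x => φ (y x)) (((1 / r x : ℝ) : ℂ) * φ' (y x)) x := by
    intro x
    have := (hφ (y x)).scomp x (hy1 x)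
    rw [Complex.real_smul] at this
    exact this
  have hF' : ∀ x, HasDerivAt (fun x => φ' (y x)) (((1 / r x : ℝ) : ℂ) * φ'' (y x)) x := by
    intro x
    have := (hφ' (y x)).scomp x (hy1 x)
    rw [Complex.real_smul] at this
    exact this
  have hq0 : ∀ x, ((Real.sqrt (r x) : ℝ) : ℂ) ≠ 0 := fun x => by
    exact_mod_cast (Real.sqrt_pos.2 (hrpos x)).ne'
  have hqq : ∀ x, (r x : ℂ) = ((Real.sqrt (r x) : ℝ) : ℂ) ^ 2 := fun x => by
    exact_mod_cast (Real.sq_sqrt (hrpos x).le).symm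
  have hD : ∀ x, HasDerivAt
      (fun x => (((deriv r x : ℝ) : ℂ) * φ (y x) / 2 + φ' (y x)) / ((Real.sqrt (r x) : ℝ) : ℂ))
      _ x := fun x =>
    (((((hr2 x).ofReal_comp).mul (hF x)).div_const 2).add (hF' x)).div (hq x) (hq0 x)
  refine ⟨_, _, ?_, hD, ?_⟩
  · intro x
    rw [funext hψ]
    refine ((hq x).mul (hF x)).congr_deriv ?_
    have h0 := hq0 x
    push_cast
    rw [hqq x]
    field_simp
  · intro x
    have h0 := hq0 x
    have hs := hschr (y x)
    rw [hu x] at hs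
    have e : φ'' (y x) = ((1 / 4 * (deriv r x) ^ 2 - 1 / 2 * r x * deriv (deriv r) x : ℝ) : ℂ)
        * φ (y x) - lam * φ (y x) := by linear_combination -hs
    simp only [Pi.mul_apply, Pi.add_apply, e, hψ]
    push_cast
    rw [hqq x]
    field_simp
    ring
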